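/- Let N ≥ 3, a, b > 0 and g : ℝ → ℝ. Suppose u ∈ C²(ℝ^N) with ∫_{ℝ^N}|∇u|² < ∞ satisfies the Kirchhoff equation −(a + b∫_{ℝ^N}|∇u|²)·Δu(x) = g(u(x)) for all x ∈ ℝ^N. Set h = √(a + b∫_{ℝ^N}|∇u|²) and define v(x) = u(h·x). Then v ∈ C²(ℝ^N), ∫_{ℝ^N}|∇v|² < ∞, v satisfies −Δv(x) = g(v(x)) for all x ∈ ℝ^N, and t = 1/h > 0 satisfies t²·a + t^{4−N}·b·∫_{ℝ^N}|∇v|² = 1 and u(x) = v(t·x) for all x. -/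

import Mathlib

open MeasureTheory

/-- The Laplacian of `u : ℝ^N → ℝ`, as the sum of second partial derivatives
along the standard basis directions. -/
noncomputable def lap {N : ℕ} (u : EuclideanSpace ℝ (Fin N) → ℝ)
    (x : EuclideanSpace ℝ (Fin N)) : ℝ :=
  ∑ i : Fin N,
    fderiv ℝ (fun y => fderiv ℝ u y (EuclideanSpace.single i 1)) x (EuclideanSpace.single i 1)

/-- The Dirichlet energy `∫_{ℝ^N} |∇u|²`. -/
noncomputable def dirichlet {N : ℕ} (u : EuclideanSpace ℝ (Fin N) → ℝ) : ℝ :=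
  ∫ x, ‖gradient u x‖ ^ 2

theorem gradient_comp_smul {N : ℕ} (u : EuclideanSpace ℝ (Fin N) → ℝ) (c : ℝ)
    (x : EuclideanSpace ℝ (Fin N)) :
    gradient (fun y => u (c • y)) x = c • gradient u (c • x) := by
  simp [gradient, fderiv_comp_smul]

theorem norm_gradient_comp_smul_sq {N : ℕ} (u : EuclideanSpace ℝ (Fin N) → ℝ) (c : ℝ)
    (x : EuclideanSpace ℝ (Fin N)) :
    ‖gradient (fun y => u (c • y)) x‖ ^ 2 = c ^ 2 * ‖gradient u (c • x)‖ ^ 2 := by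
  rw [gradient_comp_smul, norm_smul, mul_pow, Real.norm_eq_abs, sq_abs]

theorem lap_comp_smul {N : ℕ} (u : EuclideanSpace ℝ (Fin N) → ℝ) (c : ℝ)
    (x : EuclideanSpace ℝ (Fin N)) :
    lap (fun y => u (c • y)) x = c ^ 2 * lap u (c • x) := by
  unfold lap
  rw [Finset.mul_sum]
  refine Finset.sum_congr rfl fun i _ => ?_
  set e : EuclideanSpace ℝ (Fin N) := EuclideanSpace.single i 1
  have key : (fun y => fderiv ℝ (fun z => u (c • z)) y e) =
      c • fun y => (fun z => fderiv ℝ u z e) (c • y) := by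
    funext y
    simp [fderiv_comp_smul]
  rw [key, fderiv_const_smul_field, Pi.smul_apply, fderiv_comp_smul (f := fun z => fderiv ℝ u z e)]
  simp only [_root_.smul_apply, smul_eq_mul]
  ring

theorem dirichlet_comp_smul {N : ℕ} (u : EuclideanSpace ℝ (Fin N) → ℝ) {c : ℝ} (hc : 0 ≤ c) :
    dirichlet (fun y => u (c • y)) = c ^ 2 * ((c ^ N)⁻¹ * dirichlet u) := by
  unfold dirichlet
  simp_rw [norm_gradient_comp_smul_sq]
  rw [integral_const_mul,
    Measure.integral_comp_smul_of_nonneg volume (fun x => ‖gradient u x‖ ^ 2) c (hR := hc)]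
  simp

theorem dirichlet_nonneg {N : ℕ} (u : EuclideanSpace ℝ (Fin N) → ℝ) : 0 ≤ dirichlet u :=
  integral_nonneg fun _ => by positivity

theorem stmt1 {N : ℕ} (hN : 3 ≤ N) (a b : ℝ) (ha : 0 < a) (hb : 0 < b)
    (g : ℝ → ℝ) (u : EuclideanSpace ℝ (Fin N) → ℝ)
    (hu : ContDiff ℝ 2 u)
    (huInt : Integrable (fun x => ‖gradient u x‖ ^ 2))
    (huEq : ∀ x, -((a + b * dirichlet u) * lap u x) = g (u x))
    (h : ℝ) (hh : h = Real.sqrt (a + b * dirichlet u))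
    (v : EuclideanSpace ℝ (Fin N) → ℝ) (hv : v = fun x => u (h • x)) :
    ContDiff ℝ 2 v ∧
    Integrable (fun x => ‖gradient v x‖ ^ 2) ∧
    (∀ x, -lap v x = g (v x)) ∧
    0 < 1 / h ∧
    (1 / h) ^ 2 * a + (1 / h) ^ ((4 : ℝ) - N) * b * dirichlet v = 1 ∧
    ∀ x, u x = v ((1 / h) • x) := by
  have hpos : 0 < a + b * dirichlet u := by
    have := mul_nonneg hb.le (dirichlet_nonneg u)
    linarith
  have h_pos : 0 < h := hh ▸ Real.sqrt_pos.2 hpos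
  have h_sq : h ^ 2 = a + b * dirichlet u := by rw [hh, Real.sq_sqrt hpos.le]
  subst hv
  refine ⟨hu.comp (contDiff_const_smul h), ?_, fun x => ?_, by positivity, ?_, fun x => ?_⟩
  · simp_rw [norm_gradient_comp_smul_sq]
    exact ((integrable_comp_smul_iff volume (fun x => ‖gradient u x‖ ^ 2) h_pos.ne').2
      huInt).const_mul _
  · rw [lap_comp_smul, h_sq, huEq]
  · have hpow : (1 / h) ^ ((4 : ℝ) - N) = h ^ N / h ^ 4 := by
      rw [one_div, Real.inv_rpow h_pos.le, Real.rpow_sub h_pos, Real.rpow_natCast]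
      norm_num
    rw [dirichlet_comp_smul u h_pos.le, hpow]
    field_simp
    linarith
  · simp [smul_smul, h_pos.ne']
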